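/- arXiv:1106.1968 — 3 statements merged into one kernel-verified Lean document; each statement's English description precedes it below -/
import Mathlib

section
/- Let θ be an irrational number, d a nonzero integer, and f : 𝕋 → ℝ a smooth function with mean value η. Then every continuous map ψ : T² → T² satisfying ψ ∘ φ_{θ,d,f} = φ_{θ,d,0} ∘ ψ is of the form ψ(x, y) = (x·e^{2πi(mθ + η + k)/d}, x^m·y·e^{2πi g(x)}) for some integers m and k and some continuous function g : 𝕋 → ℝ with g(x) − g(e^{2πiθ}x) = f(x) − η for all x ∈ 𝕋. In particular, any such ψ is a homeomorphism of T² that preserves the Haar measure of T². -/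
open MeasureTheory

noncomputable instance : MeasurableSpace Circle := borel Circle
instance : BorelSpace Circle := ⟨rfl⟩

/-- The Furstenberg transformation `φ_{θ,d,f}` of the two-torus `𝕋 × 𝕋`:
`(x, y) ↦ (x·e^{2πiθ}, x^d·y·e^{2πi f(x)})`. -/
noncomputable def furstenberg (θ : ℝ) (d : ℤ) (f : Circle → ℝ) :
    Circle × Circle → Circle × Circle :=
  fun p => (p.1 * Circle.exp (2 * Real.pi * θ),
    p.1 ^ d * p.2 * Circle.exp (2 * Real.pi * f p.1))

/-- The mean value `η = ∫_𝕋 f dm` of a function on the circle with respect to the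
normalized Haar measure, computed as `∫₀¹ f(e^{2πit}) dt`. -/
noncomputable def circleMean (f : Circle → ℝ) : ℝ :=
  ∫ t in (0:ℝ)..1, f (Circle.exp (2 * Real.pi * t))

open scoped FourierTransform

lemma fourierChar_eq_iff {a b : ℝ} : 𝐞 a = 𝐞 b ↔ ∃ k : ℤ, a = b + k := by
  rw [Real.fourierChar_apply', Real.fourierChar_apply', Circle.exp_eq_exp]
  refine exists_congr fun k => ⟨fun h => ?_, fun h => ?_⟩
  · have : (2 * Real.pi) * a = (2 * Real.pi) * (b + k) := by rw [h]; ring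
    exact mul_left_cancel₀ Real.two_pi_pos.ne' this
  · rw [h]; ring

lemma fourierChar_intCast (k : ℤ) : 𝐞 (k : ℝ) = 1 := by
  rw [← 𝐞.map_zero_eq_one]
  exact fourierChar_eq_iff.2 ⟨k, by simp⟩

lemma fourierChar_one : 𝐞 1 = 1 := by simpa using fourierChar_intCast 1

lemma fourierChar_intCast_mul (k : ℤ) (t : ℝ) : 𝐞 (k * t) = 𝐞 t ^ k := by
  rw [← zsmul_eq_mul, 𝐞.map_zsmul_eq_zpow]

lemma fourierChar_surjective : Function.Surjective 𝐞 := fun z => by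
  obtain ⟨t, rfl⟩ := Circle.exp_surjective z
  exact ⟨t / (2 * Real.pi), by
    rw [Real.fourierChar_apply', mul_div_cancel₀ _ Real.two_pi_pos.ne']⟩

lemma isCoveringMap_fourierChar : IsCoveringMap 𝐞 :=
  Circle.isCoveringMap_exp.comp_homeomorph (Homeomorph.mulLeft₀ (2 * Real.pi) Real.two_pi_pos.ne')

lemma isOpenQuotientMap_fourierChar : IsOpenQuotientMap 𝐞 :=
  ⟨fourierChar_surjective, Real.continuous_fourierChar, isCoveringMap_fourierChar.isOpenMap⟩

lemma exists_eq_add_intCast_of_fourierChar_eq {X : Type*} [TopologicalSpace X]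
    [ConnectedSpace X] {h : X → ℝ} (hh : Continuous h) {c : ℝ} (hc : ∀ x, 𝐞 (h x) = 𝐞 c) :
    ∃ k : ℤ, ∀ x, h x = c + k := by
  obtain ⟨x₀⟩ := (inferInstance : Nonempty X)
  obtain ⟨k, hk⟩ := fourierChar_eq_iff.1 (hc x₀)
  refine ⟨k, fun x => ?_⟩
  rw [← hk]
  exact isCoveringMap_fourierChar.const_of_comp hh (fun a a' => by simp [hc]) x x₀

/-- A continuous map from the two-torus to the circle is a monomial times the exponential of a
continuous real function. -/
lemma exists_eq_zpow_mul_zpow_mul_fourierChar {b : Circle × Circle → Circle} (hb : Continuous b) :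
    ∃ (m n : ℤ) (g : Circle × Circle → ℝ), Continuous g ∧
      ∀ p, b p = p.1 ^ m * p.2 ^ n * 𝐞 (g p) := by
  have hq : IsOpenQuotientMap (Prod.map 𝐞 𝐞) :=
    isOpenQuotientMap_fourierChar.prodMap isOpenQuotientMap_fourierChar
  obtain ⟨e₀, he₀⟩ := fourierChar_surjective (b (Prod.map 𝐞 𝐞 (0, 0)))
  obtain ⟨B, ⟨-, hB⟩, -⟩ := isCoveringMap_fourierChar.existsUnique_continuousMap_lifts
    ⟨fun p : ℝ × ℝ => b (Prod.map 𝐞 𝐞 p), hb.comp hq.continuous⟩ (0, 0) e₀ he₀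
  replace hB : ∀ s t, 𝐞 (B (s, t)) = b (𝐞 s, 𝐞 t) := fun s t => congrFun hB (s, t)
  obtain ⟨m, hm⟩ := exists_eq_add_intCast_of_fourierChar_eq (c := 0)
    (h := fun p : ℝ × ℝ => B (p.1 + 1, p.2) - B p) (by fun_prop) fun p => by
      rw [AddChar.map_sub_eq_div, hB, hB, AddChar.map_add_eq_mul, fourierChar_one]; simp
  obtain ⟨n, hn⟩ := exists_eq_add_intCast_of_fourierChar_eq (c := 0)
    (h := fun p : ℝ × ℝ => B (p.1, p.2 + 1) - B p) (by fun_prop) fun p => by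
      rw [AddChar.map_sub_eq_div, hB, hB, AddChar.map_add_eq_mul, fourierChar_one]; simp
  let G : ℝ × ℝ → ℝ := fun p => B p - (m * p.1 + n * p.2)
  have hG₁ : ∀ t, Function.Periodic (fun s => G (s, t)) 1 := fun t s => by
    have := hm (s, t)
    simp only [G] at *
    linarith
  have hG₂ : ∀ s, Function.Periodic (fun t => G (s, t)) 1 := fun s t => by
    have := hn (s, t)
    simp only [G] at *
    linarith
  let σ := Function.surjInv fourierChar_surjective
  have hgG : ∀ s t, G (σ (𝐞 s), σ (𝐞 t)) = G (s, t) := fun s t => by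
    obtain ⟨k, hk⟩ := fourierChar_eq_iff.1 (Function.surjInv_eq fourierChar_surjective (𝐞 s))
    obtain ⟨l, hl⟩ := fourierChar_eq_iff.1 (Function.surjInv_eq fourierChar_surjective (𝐞 t))
    have h₁ := (hG₁ (t + l)).int_mul k s
    have h₂ := (hG₂ s).int_mul l t
    simp only [σ, hk, hl]
    simp only [mul_one] at h₁ h₂
    rw [h₁, h₂]
  refine ⟨m, n, fun p => G (σ p.1, σ p.2), ?_, ?_⟩
  · rw [hq.isQuotientMap.continuous_iff]
    have : (fun p : Circle × Circle => G (σ p.1, σ p.2)) ∘ Prod.map 𝐞 𝐞 = G :=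
      funext fun p => hgG p.1 p.2
    rw [this]
    fun_prop
  · rintro ⟨x, y⟩
    obtain ⟨s, rfl⟩ := fourierChar_surjective x
    obtain ⟨t, rfl⟩ := fourierChar_surjective y
    simp only [hgG, ← hB, ← fourierChar_intCast_mul, ← AddChar.map_add_eq_mul, G]
    congr 1
    ring

/-- A nontrivial character of the circle has no continuous logarithm. -/
lemma eq_zero_of_zpow_eq_fourierChar {m : ℤ} {h : Circle → ℝ}
    (hh : Continuous h) (H : ∀ x, x ^ m = 𝐞 (h x)) : m = 0 := by
  have he := Real.continuous_fourierChar
  obtain ⟨k, hk⟩ := exists_eq_add_intCast_of_fourierChar_eq (c := 0)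
    (h := fun t : ℝ => m * t - h (𝐞 t)) (by fun_prop) fun t => by
      rw [AddChar.map_sub_eq_div, fourierChar_intCast_mul, H]; simp
  have h₀ := hk 0
  have h₁ := hk 1
  simp only [fourierChar_one, AddChar.map_zero_eq_one] at h₀ h₁
  have : (m : ℝ) = 0 := by linarith
  exact_mod_cast this

lemma integral_circle_mul_left {E : Type*} [NormedAddCommGroup E] [NormedSpace ℝ E]
    (F : Circle → E) (w : Circle) :
    ∫ t in (0 : ℝ)..1, F (w * 𝐞 t) = ∫ t in (0 : ℝ)..1, F (𝐞 t) := by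
  obtain ⟨s, rfl⟩ := fourierChar_surjective w
  have hper : Function.Periodic (fun t : ℝ => F (𝐞 t)) 1 := fun t => by
    simp [AddChar.map_add_eq_mul, fourierChar_one]
  have := hper.intervalIntegral_add_eq s 0
  simp only [← AddChar.map_add_eq_mul]
  rw [intervalIntegral.integral_comp_add_left (fun t => F (𝐞 t)) s]
  simpa using this

/-- A continuous function invariant under an irrational rotation is constant. -/
lemma eq_of_invariant_irrational_rotation {Y : Type*} [TopologicalSpace Y] [T2Space Y]
    {θ : ℝ} (hθ : Irrational θ) {F : Circle → Y} (hF : Continuous F)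
    (hinv : ∀ x, F (x * 𝐞 θ) = F x) (x x' : Circle) : F x = F x' := by
  suffices H : ∀ x, F x = F 1 by rw [H x, H x']
  clear x x'
  intro x
  have hd : DenseRange fun n : ℤ => 𝐞 θ ^ n := by
    have h₁ : DenseRange (· • (θ : AddCircle (1 : ℝ)) : ℤ → AddCircle (1 : ℝ)) :=
      AddCircle.denseRange_zsmul_coe_iff.2 (by simpa using hθ)
    have h₂ := (AddCircle.homeomorphCircle (one_ne_zero (α := ℝ))).surjective.denseRange.comp h₁
      (AddCircle.homeomorphCircle (one_ne_zero (α := ℝ))).continuous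
    convert h₂ using 2 with n
    simp only [Function.comp, AddCircle.homeomorphCircle_apply, AddCircle.toCircle_zsmul,
      AddCircle.toCircle_apply_mk, Real.fourierChar_apply', div_one]
  refine hd.induction_on (p := fun x => F x = F 1) x (isClosed_eq hF continuous_const) fun n => ?_
  induction n with
  | zero => simp
  | succ n ih => rw [zpow_add_one, hinv, ih]
  | pred n ih => rw [← ih, ← hinv (𝐞 θ ^ (-(n : ℤ) - 1)), zpow_sub_one, inv_mul_cancel_right]

/-- A continuous function on the circle whose nonzero Fourier coefficients vanish is constant. -/
lemma eq_of_fourier_integral_eq_zero {F : Circle → ℂ} (hF : Continuous F)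
    (h : ∀ n : ℤ, n ≠ 0 → ∫ t in (0 : ℝ)..1, ((𝐞 t ^ (-n) : Circle) : ℂ) * F (𝐞 t) = 0)
    (y y' : Circle) : F y = F y' := by
  let e := AddCircle.homeomorphCircle (one_ne_zero (α := ℝ))
  let f : C(AddCircle (1 : ℝ), ℂ) := ⟨fun t => F (e t), hF.comp e.continuous⟩
  have hcoeff : ∀ n : ℤ, n ≠ 0 → fourierCoeff f n = 0 := fun n hn => by
    rw [fourierCoeff_eq_intervalIntegral _ _ 0, zero_add, one_div_one, one_smul, ← h n hn]
    refine intervalIntegral.integral_congr fun t _ => ?_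
    simp only [f, e, ContinuousMap.coe_mk, fourier_apply, AddCircle.toCircle_zsmul,
      AddCircle.homeomorphCircle_apply, AddCircle.toCircle_apply_mk, Real.fourierChar_apply',
      div_one, smul_eq_mul]
  have hsum : Summable (fourierCoeff f) :=
    summable_of_ne_finset_zero (s := {0}) fun n hn => hcoeff n (by simpa using hn)
  have hf : f = fourierCoeff f 0 • fourier 0 :=
    (hasSum_fourier_series_of_summable hsum).unique
      (hasSum_single 0 fun n hn => by rw [hcoeff n hn]; exact zero_smul ℂ (fourier n))
  have hconst : ∀ y, F y = fourierCoeff f 0 := fun y => by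
    have := congrArg (fun k : C(AddCircle (1 : ℝ), ℂ) => k (e.symm y)) hf
    simpa [f] using this
  rw [hconst, hconst]

/-- A continuous function on the torus invariant under a Furstenberg transformation with nonzero
degree is constant. -/
lemma eq_of_invariant_furstenberg {θ : ℝ} (hθ : Irrational θ) {d : ℤ} (hd : d ≠ 0)
    {f : Circle → ℝ} (hf : Continuous f) {H : Circle × Circle → ℂ} (hH : Continuous H)
    (hinv : ∀ p, H (furstenberg θ d f p) = H p) (p q : Circle × Circle) : H p = H q := by
  have he := Real.continuous_fourierChar
  let c : ℤ → Circle → ℂ := fun n x =>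
    ∫ t in (0 : ℝ)..1, ((𝐞 t ^ (-n) : Circle) : ℂ) * H (x, 𝐞 t)
  have hc : ∀ n, Continuous (c n) := fun n =>
    intervalIntegral.continuous_parametric_intervalIntegral_of_continuous' 
      ((continuous_subtype_val.comp ((he.comp continuous_snd).zpow (-n))).mul
        (hH.comp (continuous_fst.prodMk (he.comp continuous_snd)))) 0 1
  have hstep : ∀ n x, c n (x * 𝐞 θ) = ((x ^ d * 𝐞 (f x)) ^ (-n) : Circle) * c n x := fun n x => by
    simp only [c]
    rw [← integral_circle_mul_left (fun y => ((y ^ (-n) : Circle) : ℂ) * H (x * 𝐞 θ, y))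
      (x ^ d * 𝐞 (f x)), ← intervalIntegral.integral_const_mul]
    refine intervalIntegral.integral_congr fun t _ => ?_
    have h₁ : (x * 𝐞 θ, x ^ d * 𝐞 (f x) * 𝐞 t) = furstenberg θ d f (x, 𝐞 t) := by
      simp only [furstenberg, Real.fourierChar_apply', mul_right_comm]
    rw [h₁, hinv, mul_zpow _ (𝐞 t), Circle.coe_mul, mul_assoc]
  have hnorm : ∀ n x x', ‖c n x‖ = ‖c n x'‖ := fun n =>
    eq_of_invariant_irrational_rotation hθ (hc n).norm fun x => by
      rw [hstep, norm_mul, Circle.norm_coe, one_mul]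
  have hzero : ∀ n, n ≠ 0 → ∀ x, c n x = 0 := by
    intro n hn x₀
    by_contra hx₀
    have hr : ‖c n x₀‖ ≠ 0 := norm_ne_zero_iff.2 hx₀
    let u : Circle → Circle := fun x => ⟨c n x / ‖c n x₀‖, by
      simp [Submonoid.unitSphere, hnorm n x x₀, hr]⟩
    have hu : Continuous u := ((hc n).div_const _).subtype_mk _
    have hustep : ∀ x, u (x * 𝐞 θ) = (x ^ d * 𝐞 (f x)) ^ (-n) * u x := fun x => by
      ext
      rw [Circle.coe_mul]
      change c n (x * 𝐞 θ) / _ = _ * (c n x / _)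
      rw [hstep, mul_div_assoc]
    obtain ⟨a, _, g, hg, hug⟩ :=
      exists_eq_zpow_mul_zpow_mul_fourierChar (b := fun p => u p.1) (by fun_prop)
    replace hug : ∀ x, u x = x ^ a * 𝐞 (g (x, 1)) := fun x => by simpa using hug (x, 1)
    refine mul_ne_zero hd hn (eq_zero_of_zpow_eq_fourierChar
      (h := fun x => g (x, 1) - g (x * 𝐞 θ, 1) - n * f x - a * θ) (by fun_prop) fun x => ?_)
    have h₁ := hustep x
    rw [hug, hug] at h₁
    simp only [AddChar.map_sub_eq_div, fourierChar_intCast_mul]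
    simp only [mul_zpow, zpow_neg, ← zpow_mul] at h₁
    rw [eq_div_iff_mul_eq', eq_div_iff_mul_eq', eq_div_iff_mul_eq']
    have h₂ : x ^ a * (x ^ (d * n) * (𝐞 (f x) ^ n) * 𝐞 θ ^ a * 𝐞 (g (x * 𝐞 θ, 1)))
        = x ^ a * 𝐞 (g (x, 1)) := by
      calc _ = x ^ (d * n) * 𝐞 (f x) ^ n * (x ^ a * 𝐞 θ ^ a * 𝐞 (g (x * 𝐞 θ, 1))) := by
            ac_rfl
        _ = _ := by rw [h₁]; group
    rw [← mul_left_cancel h₂]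
    ac_rfl
  have hfib : ∀ x y y', H (x, y) = H (x, y') := fun x =>
    eq_of_fourier_integral_eq_zero (F := fun y => H (x, y)) (by fun_prop)
      fun n hn => hzero n hn x
  have hbase : ∀ x x', H (x, 1) = H (x', 1) :=
    eq_of_invariant_irrational_rotation hθ (F := fun x => H (x, 1)) (by fun_prop) fun x => by
      rw [← hinv (x, 1), furstenberg]
      exact hfib _ _ _
  rw [← Prod.mk.eta (p := p), ← Prod.mk.eta (p := q), hfib p.1 p.2 1, hfib q.1 q.2 1, hbase]

lemma continuous_of_continuous_comp_fourierChar {Y : Type*} [TopologicalSpace Y] {f : Circle → Y}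
    (hf : Continuous fun t : ℝ => f (𝐞 t)) : Continuous f :=
  isOpenQuotientMap_fourierChar.isQuotientMap.continuous_iff.2 hf

/-- If `f` differs from a constant `C` by a coboundary over a Furstenberg transformation, then the
constant is the mean of `f`. -/
lemma circleMean_eq_of_coboundary {θ : ℝ} {d : ℤ} {f : Circle → ℝ}
    {g : Circle × Circle → ℝ} (hg : Continuous g) {C : ℝ}
    (h : ∀ p, g p - g (furstenberg θ d f p) = f p.1 - C) :
    circleMean f = C ∧ ∃ g₀ : Circle → ℝ, Continuous g₀ ∧
      ∀ x, g₀ x - g₀ (x * 𝐞 θ) = f x - C := by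
  have he := Real.continuous_fourierChar
  let g₀ : Circle → ℝ := fun x => ∫ t in (0 : ℝ)..1, g (x, 𝐞 t)
  have hg₀ : Continuous g₀ := intervalIntegral.continuous_parametric_intervalIntegral_of_continuous'
    (f := fun x t => g (x, 𝐞 t)) (hg.comp (continuous_fst.prodMk (he.comp continuous_snd))) 0 1
  have hcob : ∀ x, g₀ x - g₀ (x * 𝐞 θ) = f x - C := fun x => by
    have h₁ : g₀ (x * 𝐞 θ) = ∫ t in (0 : ℝ)..1, g (furstenberg θ d f (x, 𝐞 t)) := by
      simp only [g₀]
      rw [← integral_circle_mul_left (fun y => g (x * 𝐞 θ, y)) (x ^ d * 𝐞 (f x))]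
      simp only [furstenberg, Real.fourierChar_apply', mul_right_comm]
    have h₂ : ∀ t, g (furstenberg θ d f (x, 𝐞 t)) = g (x, 𝐞 t) - (f x - C) := fun t => by
      rw [← h (x, 𝐞 t)]; ring
    have hi : IntervalIntegrable (fun t => g (x, 𝐞 t)) volume 0 1 :=
      Continuous.intervalIntegrable (by fun_prop) _ _
    simp only [h₁, h₂, g₀]
    rw [intervalIntegral.integral_sub hi (by simp)]
    simp
  refine ⟨?_, g₀, hg₀, hcob⟩
  have hf : ∀ t, f (𝐞 t) = g₀ (𝐞 t) - g₀ (𝐞 θ * 𝐞 t) + C := fun t => by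
    rw [mul_comm, hcob]; ring
  have hi : IntervalIntegrable (fun t => g₀ (𝐞 t)) volume 0 1 :=
    Continuous.intervalIntegrable (by fun_prop) _ _
  have hi' : IntervalIntegrable (fun t => g₀ (𝐞 θ * 𝐞 t)) volume 0 1 :=
    Continuous.intervalIntegrable (by fun_prop) _ _
  change ∫ t in (0 : ℝ)..1, f (𝐞 t) = C
  simp only [hf]
  rw [intervalIntegral.integral_add (hi.sub hi') (by simp), intervalIntegral.integral_sub hi hi',
    integral_circle_mul_left g₀]
  simp

/-- A skew translation `(x, y) ↦ (x c, h(x) y)` of `G × G`, as a homeomorphism. -/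
def skewTranslation {G : Type*} [Group G] [TopologicalSpace G] [IsTopologicalGroup G] (c : G)
    (h : C(G, G)) : G × G ≃ₜ G × G where
  toFun p := (p.1 * c, h p.1 * p.2)
  invFun p := (p.1 * c⁻¹, (h (p.1 * c⁻¹))⁻¹ * p.2)
  left_inv p := by simp
  right_inv p := by simp
  continuous_toFun := by fun_prop
  continuous_invFun := by fun_prop

lemma measurePreserving_skewTranslation (c : Circle) (h : C(Circle, Circle)) :
    MeasurePreserving (skewTranslation c h) Measure.haar Measure.haar := by
  have hprod : MeasurePreserving (skewTranslation c h)
      ((Measure.haar : Measure Circle).prod Measure.haar)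
      ((Measure.haar : Measure Circle).prod Measure.haar) :=
    (measurePreserving_mul_right Measure.haar c).skew_product (g := fun x y => h x * y)
      (Continuous.measurable (by simp only [Function.uncurry_def]; fun_prop))
      (.of_forall fun x => map_mul_left_eq_self _ (h x))
  rw [Measure.isMulLeftInvariant_eq_smul (Measure.haar : Measure (Circle × Circle))
    ((Measure.haar : Measure Circle).prod Measure.haar)]
  exact hprod.smul_measure _

theorem furstenberg_conjugation_form
    (θ : ℝ) (hθ : Irrational θ) (d : ℤ) (hd : d ≠ 0) (f : Circle → ℝ)
    (hf : ContDiff ℝ (⊤ : ℕ∞) fun t : ℝ => f (Circle.exp (2 * Real.pi * t)))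
    (ψ : Circle × Circle → Circle × Circle) (hψ : Continuous ψ)
    (hconj : ψ ∘ furstenberg θ d f = furstenberg θ d 0 ∘ ψ) :
    (∃ (m k : ℤ) (g : Circle → ℝ), Continuous g ∧
        (∀ x : Circle, g x - g (Circle.exp (2 * Real.pi * θ) * x) = f x - circleMean f) ∧
        ∀ p : Circle × Circle, ψ p =
          (p.1 * Circle.exp (2 * Real.pi * ((m * θ + circleMean f + k) / d)),
           p.1 ^ m * p.2 * Circle.exp (2 * Real.pi * g p.1))) ∧
    (∃ Ψ : Circle × Circle ≃ₜ Circle × Circle, ⇑Ψ = ψ) ∧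
    MeasurePreserving ψ Measure.haar Measure.haar := by
  have he := Real.continuous_fourierChar
  have hfc : Continuous f := continuous_of_continuous_comp_fourierChar hf.continuous
  have hφ : ∀ p, furstenberg θ d f p = (p.1 * 𝐞 θ, p.1 ^ d * p.2 * 𝐞 (f p.1)) := fun _ => rfl
  have hψ₁ : ∀ p, (ψ (furstenberg θ d f p)).1 = (ψ p).1 * 𝐞 θ := fun p =>
    congrArg Prod.fst (congrFun hconj p)
  have hψ₂ : ∀ p, (ψ (furstenberg θ d f p)).2 = (ψ p).1 ^ d * (ψ p).2 := fun p => by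
    simpa [furstenberg] using congrArg Prod.snd (congrFun hconj p)
  -- The first coordinate is a rotation.
  obtain ⟨γ, hγ⟩ : ∃ γ, ∀ p, (ψ p).1 = p.1 * 𝐞 γ := by
    obtain ⟨γ, hγ⟩ := fourierChar_surjective ((ψ 1).1)
    refine ⟨γ, fun p => ?_⟩
    have := eq_of_invariant_furstenberg hθ hd hfc
      (H := fun p => (((ψ p).1 * p.1⁻¹ : Circle) : ℂ))
      (continuous_subtype_val.comp (hψ.fst.mul continuous_fst.inv))
      (fun p => by rw [hψ₁, hφ, mul_inv_rev, mul_assoc, mul_inv_cancel_left]) p 1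
    have h₁ : (ψ p).1 * p.1⁻¹ = (ψ 1).1 * (1 : Circle × Circle).1⁻¹ := Subtype.ext this
    rw [hγ, mul_inv_eq_iff_eq_mul.1 h₁]
    simp [mul_comm]
  -- The second coordinate is a monomial times an exponential, and the `y`-degree is one.
  obtain ⟨m, n, g, hg, hψg⟩ := exists_eq_zpow_mul_zpow_mul_fourierChar hψ.snd
  have hmon : ∀ x y, x ^ (d * n - d)
      = 𝐞 (g (x, y) - g (furstenberg θ d f (x, y)) + (d * γ - m * θ) - n * f x) := fun x y => by
    have h₁ := hψ₂ (x, y)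
    rw [hψg, hψg, hγ] at h₁
    generalize g (furstenberg θ d f (x, y)) = G₁, g (x, y) = G₀ at h₁ ⊢
    obtain ⟨r, hr⟩ : ∃ r, r = f x := ⟨_, rfl⟩
    simp only [hφ, ← hr] at h₁ ⊢
    obtain ⟨s, rfl⟩ := fourierChar_surjective x
    obtain ⟨t, rfl⟩ := fourierChar_surjective y
    simp only [← fourierChar_intCast_mul, ← AddChar.map_add_eq_mul] at h₁ ⊢
    obtain ⟨k, hk⟩ := fourierChar_eq_iff.1 h₁
    exact fourierChar_eq_iff.2 ⟨k, by push_cast; linarith⟩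
  have hφc : Continuous (furstenberg θ d f) := by
    have : furstenberg θ d f = fun p => (p.1 * 𝐞 θ, p.1 ^ d * p.2 * 𝐞 (f p.1)) := funext hφ
    rw [this]
    fun_prop
  obtain rfl : n = 1 := by
    have h₁ := eq_zero_of_zpow_eq_fourierChar
      (h := fun x => g (x, 1) - g (furstenberg θ d f (x, 1)) + (d * γ - m * θ) - n * f x)
      (by fun_prop) fun x => hmon x 1
    have h₂ : d * (n - 1) = 0 := by linarith
    have h₃ := (mul_eq_zero.1 h₂).resolve_left hd
    omega
  -- The exponent solves the cohomological equation.
  obtain ⟨k, hk⟩ := exists_eq_add_intCast_of_fourierChar_eq (c := 0)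
    (h := fun p => g p - g (furstenberg θ d f p) + (d * γ - m * θ) - f p.1) (by fun_prop)
    fun p => by simpa using (hmon p.1 p.2).symm
  obtain ⟨hmean, g₀, hg₀, hcob⟩ := circleMean_eq_of_coboundary (C := d * γ - m * θ - k) hg
    (fun p => by linarith [hk p])
  -- The exponent depends only on the first coordinate.
  have hgconst : ∀ p q, g p - g₀ p.1 = g q - g₀ q.1 := fun p q => by
    have := eq_of_invariant_furstenberg hθ hd hfc (H := fun p => ((g p - g₀ p.1 : ℝ) : ℂ))
      (by fun_prop) (fun p => by
        congr 1
        have h₁ := hk p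
        have h₂ := hcob p.1
        rw [hφ] at h₁ ⊢
        linarith) p q
    exact_mod_cast this
  have hform : ∀ p, ψ p =
      (p.1 * 𝐞 ((m * θ + circleMean f + k) / d), p.1 ^ m * p.2 * 𝐞 (g (p.1, 1))) := fun p => by
    have hγ' : (m * θ + circleMean f + k) / d = γ := by
      rw [hmean, div_eq_iff (Int.cast_ne_zero.2 hd)]
      ring
    have hg₁ : g (p.1, 1) = g p := by simpa using hgconst (p.1, 1) p
    rw [hγ', hg₁, ← hγ]
    exact Prod.ext rfl (by simpa using hψg p)
  let Ψ := skewTranslation (𝐞 ((m * θ + circleMean f + k) / d))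
    ⟨fun x => x ^ m * 𝐞 (g (x, 1)), by fun_prop⟩
  have hΨ : ⇑Ψ = ψ := funext fun p => by
    rw [hform, ← mul_right_comm]
    rfl
  refine ⟨⟨m, k, fun x => g (x, 1), by fun_prop, fun x => ?_, hform⟩, ⟨Ψ, hΨ⟩,
    hΨ ▸ measurePreserving_skewTranslation _ _⟩
  have h₁ := hcob x
  have h₂ := hgconst (x, 1) (x * 𝐞 θ, 1)
  rw [hmean, mul_comm, ← Real.fourierChar_apply']
  linarith
end

section
/- Let θ be an irrational number, d a nonzero integer, and f : 𝕋 → ℝ a smooth function with mean value η admitting a continuous function g : 𝕋 → ℝ with g(x) − g(e^{2πiθ}x) = f(x) − η for all x ∈ 𝕋 such that g is not continuously differentiable. Then the Furstenberg transformations φ_{θ,d,f} and φ_{θ,d,0} are conjugate by a homeomorphism of T², but every continuous map ψ : T² → T² satisfying ψ ∘ φ_{θ,d,f} = φ_{θ,d,0} ∘ ψ fails to be C¹; in particular φ_{θ,d,f} and φ_{θ,d,0} are topologically conjugate but not C¹-conjugate. -/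
open scoped Manifold

open MeasureTheory Filter Topology AddCircle

section FourierCoefficients

variable {T : ℝ} [hT : Fact (0 < T)]

theorem fourierCoeff_comp_add_right (f : AddCircle T → ℂ) (a : AddCircle T) (n : ℤ) :
    fourierCoeff (fun t => f (t + a)) n = fourier n a * fourierCoeff f n := by
  unfold fourierCoeff
  rw [← integral_add_right_eq_self (fun t => fourier (-n) t • f t) a, ← integral_const_mul]
  congr 1 with t
  have h : (fourier n a : ℂ) * fourier (-n) a = 1 := by
    rw [← fourier_add, add_neg_cancel, fourier_zero]
  have h' : (fourier (-n) (t + a) : ℂ) = fourier (-n) t * fourier (-n) a := by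
    simp [fourier_apply, smul_add, toCircle_add]
  rw [h', smul_eq_mul, smul_eq_mul]
  linear_combination (- fourier (-n) t * f (t + a)) * h

theorem fourierCoeff_fourier_mul (f : AddCircle T → ℂ) (k n : ℤ) :
    fourierCoeff (fun t => fourier k t * f t) n = fourierCoeff f (n - k) := by
  unfold fourierCoeff
  congr 1 with t
  rw [show -(n - k) = -n + k by ring, fourier_add, smul_eq_mul, smul_eq_mul, mul_assoc]

/-- Fourier coefficients of a continuous function tend to zero at infinity. -/
theorem tendsto_fourierCoeff_cofinite (f : C(AddCircle T, ℂ)) :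
    Tendsto (fun n => ‖fourierCoeff f n‖) cofinite (𝓝 0) := by
  have h := (hasSum_sq_fourierCoeff
    (ContinuousMap.toLp (E := ℂ) 2 haarAddCircle ℂ f)).summable.tendsto_cofinite_zero
  simp_rw [fourierCoeff_toLp] at h
  simpa using h.sqrt

/-- A continuous function with at most one nonzero Fourier coefficient is a monomial. -/
theorem eq_fourierCoeff_mul_fourier (f : C(AddCircle T, ℂ)) (j : ℤ)
    (h : ∀ n, n ≠ j → fourierCoeff f n = 0) (t : AddCircle T) :
    f t = fourierCoeff f j * fourier j t := by
  have hs : Summable (fourierCoeff f) := (hasSum_single j h).summable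
  refine (has_pointwise_sum_fourier_series_of_summable hs t).unique (hasSum_single j ?_)
  intro n hn
  simp [h n hn]

theorem continuous_fourierCoeff {X : Type*} [TopologicalSpace X] [FirstCountableTopology X]
    [LocallyCompactSpace X] {F : X → AddCircle T → ℂ} (hF : Continuous F.uncurry) (n : ℤ) :
    Continuous fun x => fourierCoeff (F x) n := by
  have h := continuous_parametric_integral_of_continuous (μ := haarAddCircle (T := T))
    (f := fun x t => fourier (-n) t • F x t) (s := Set.univ)
    (((fourier (-n)).continuous.comp continuous_snd).smul hF) isCompact_univ
  rw [Measure.restrict_univ] at h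
  exact h

/-- A continuous function twisted by a nontrivial character under a rotation vanishes. -/
theorem eq_zero_of_comp_add_eq (v : C(AddCircle T, ℂ)) (a : AddCircle T) {μ : ℂ} (hμ : ‖μ‖ = 1)
    {k : ℤ} (hk : k ≠ 0) (h : ∀ s, fourier k s * v (s + a) = μ * v s) (s : AddCircle T) :
    v s = 0 := by
  have step : ∀ n, ‖fourierCoeff v (n - k)‖ = ‖fourierCoeff v n‖ := by
    intro n
    have h1 : fourierCoeff (fun s => fourier k s * v (s + a)) n
        = fourierCoeff (fun s => μ * v s) n := by simp_rw [h]
    rw [fourierCoeff_fourier_mul (fun s => v (s + a)), fourierCoeff_comp_add_right,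
      fourierCoeff.const_mul] at h1
    have h2 := congrArg norm h1
    simpa [hμ, fourier_apply, Circle.norm_coe] using h2
  have iter : ∀ (n : ℤ) (m : ℕ), ‖fourierCoeff v (n - m * k)‖ = ‖fourierCoeff v n‖ := by
    intro n m
    induction m with
    | zero => simp
    | succ m ih =>
      rw [← ih, ← step (n - m * k)]
      congr 2
      push_cast
      ring
  have zero : ∀ n, fourierCoeff v n = 0 := by
    intro n
    have hinj : Function.Injective fun m : ℕ => n - m * k := by
      intro a b hab
      simpa [hk] using hab
    have ht := (tendsto_fourierCoeff_cofinite v).comp hinj.tendsto_cofinite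
    simp only [Function.comp_def, iter] at ht
    exact norm_eq_zero.1 (tendsto_nhds_unique tendsto_const_nhds ht)
  rw [eq_fourierCoeff_mul_fourier v 0 (fun n _ => zero n), zero, zero_mul]

end FourierCoefficients

theorem Irrational.zpow_circleExp_injective {θ : ℝ} (hθ : Irrational θ) :
    Function.Injective fun n : ℤ => Circle.exp (2 * Real.pi * θ) ^ n := by
  intro n m h
  simp only [← Circle.exp_intCast_mul] at h
  obtain ⟨k, hk⟩ := Circle.exp_eq_exp.1 h
  by_contra hne
  have h1 : ((n - m : ℤ) : ℝ) * θ = k := by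
    have := Real.pi_pos
    have h2 : (2 * Real.pi) * (((n - m : ℤ) : ℝ) * θ) = 2 * Real.pi * k := by
      push_cast; linarith
    exact mul_left_cancel₀ (by positivity) h2
  exact (hθ.intCast_mul (sub_ne_zero.2 hne)).ne_int k h1

/-- A continuous eigenfunction of an affine Anzai skew product depends only on the first
coordinate, through a character. -/
theorem exists_eq_mul_zpow_of_eigenfunction {θ : ℝ} (hθ : Irrational θ) {d : ℤ} (hd : d ≠ 0)
    {u : Circle × Circle → Circle} (hu : Continuous u) (μ : Circle)
    (h : ∀ x y, u (x * Circle.exp (2 * Real.pi * θ), x ^ d * y) = μ * u (x, y)) :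
    ∃ (k : ℤ) (a : Circle), ∀ x y, u (x, y) = a * x ^ k := by
  let U : AddCircle (1 : ℝ) → AddCircle (1 : ℝ) → ℂ := fun s t => u (toCircle s, toCircle t)
  have hU : Continuous U.uncurry := by
    refine continuous_induced_dom.comp (hu.comp ?_)
    exact (continuous_toCircle.comp continuous_fst).prodMk
      (continuous_toCircle.comp continuous_snd)
  have htθ : toCircle ((θ : ℝ) : AddCircle (1 : ℝ)) = Circle.exp (2 * Real.pi * θ) := by
    rw [toCircle_apply_mk, div_one]
  have hUφ : ∀ s t, U (s + ((θ : ℝ) : AddCircle (1 : ℝ))) (t + d • s) = μ * U s t := by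
    intro s t
    have := congrArg (fun z : Circle => (z : ℂ)) (h (toCircle s) (toCircle t))
    simpa only [U, toCircle_add, toCircle_zsmul, htθ, mul_comm (toCircle t), Circle.coe_mul]
      using this
  let c : ℤ → C(AddCircle (1 : ℝ), ℂ) := fun n =>
    ⟨fun s => fourierCoeff (U s) n, continuous_fourierCoeff hU n⟩
  have hc : ∀ n s, fourier (n * d) s * c n (s + ((θ : ℝ) : AddCircle (1 : ℝ))) = μ * c n s := by
    intro n s
    have h1 := fourierCoeff_comp_add_right (U (s + ((θ : ℝ) : AddCircle (1 : ℝ)))) (d • s) n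
    simp only [hUφ, fourierCoeff.const_mul] at h1
    rw [fourier_apply, mul_smul, ← fourier_apply]
    exact h1.symm
  have hc0 : ∀ n, n ≠ 0 → ∀ s, c n s = 0 := fun n hn =>
    eq_zero_of_comp_add_eq (c n) _ (Circle.norm_coe μ) (mul_ne_zero hn hd) (hc n)
  have hUc : ∀ s t, U s t = c 0 s := by
    intro s t
    have := eq_fourierCoeff_mul_fourier
      (⟨U s, hU.comp (Continuous.prodMk_right s)⟩ : C(AddCircle (1 : ℝ), ℂ)) 0
      (fun n hn => hc0 n hn s) t
    rwa [fourier_zero, mul_one] at this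
  have hcoef : ∀ n, (fourier n ((θ : ℝ) : AddCircle (1 : ℝ)) : ℂ) * fourierCoeff (c 0) n
      = μ * fourierCoeff (c 0) n := by
    intro n
    rw [← fourierCoeff_comp_add_right, ← fourierCoeff.const_mul]
    congr 1 with s
    simpa using hc 0 s
  obtain ⟨j, hj⟩ : ∃ j, fourierCoeff (c 0) j ≠ 0 := by
    by_contra! hall
    have h0 := eq_fourierCoeff_mul_fourier (c 0) 0 (fun n _ => hall n) 0
    rw [hall, zero_mul, ← hUc 0 0] at h0
    exact Circle.coe_ne_zero _ h0
  have hother : ∀ n, n ≠ j → fourierCoeff (c 0) n = 0 := by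
    intro n hn
    by_contra hne
    have h1 := mul_right_cancel₀ hne (hcoef n)
    have h2 := mul_right_cancel₀ hj (hcoef j)
    rw [← h2, fourier_apply, fourier_apply, Circle.coe_inj, toCircle_zsmul, toCircle_zsmul,
      htθ] at h1
    exact hn (hθ.zpow_circleExp_injective h1)
  have hfin : ∀ s t, U s t = fourierCoeff (c 0) j * fourier j s := fun s t => by
    rw [hUc, eq_fourierCoeff_mul_fourier (c 0) j hother]
  refine ⟨j, u (1, 1), fun x y => ?_⟩
  have hsurj : Function.Surjective (toCircle : AddCircle (1 : ℝ) → Circle) := fun z => by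
    obtain ⟨s, hs⟩ := (homeomorphCircle (T := 1) one_ne_zero).surjective z
    exact ⟨s, by rw [← hs, homeomorphCircle_apply]⟩
  obtain ⟨s, rfl⟩ := hsurj x
  obtain ⟨t, rfl⟩ := hsurj y
  have h1 := hfin s t
  have h0 := hfin 0 0
  simp only [U, fourier_eval_zero, mul_one, toCircle_zero] at h0 h1
  apply Circle.ext
  rw [h1, ← h0, fourier_apply, toCircle_zsmul, Circle.coe_mul]

/-- A continuous function is `C¹` as soon as its exponential is. -/
theorem contDiff_of_contDiff_circleExp {G : ℝ → ℝ} (hG : Continuous G)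
    (h : ContDiff ℝ 1 fun t => (Circle.exp (G t) : ℂ)) : ContDiff ℝ 1 G := by
  rw [contDiff_iff_contDiffAt]
  intro t₀
  have hE : ContDiff ℝ 1 fun t => (Circle.exp (G t - G t₀) : ℂ) := by
    simp only [Circle.exp_sub, Circle.coe_div]
    exact h.div_const _
  have hlog : ContDiffAt ℝ 1 (fun t => Complex.log (Circle.exp (G t - G t₀))) t₀ := by
    refine (Complex.contDiffAt_log (n := 1) ?_).restrict_scalars ℝ |>.comp t₀ hE.contDiffAt
    simp
  have him : ContDiffAt ℝ 1 (fun t => (Complex.log (Circle.exp (G t - G t₀))).im + G t₀) t₀ :=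
    (Complex.imCLM.contDiff.contDiffAt.comp t₀ hlog).add contDiffAt_const
  refine him.congr_of_eventuallyEq ?_
  have hnear : ∀ᶠ t in 𝓝 t₀, |G t - G t₀| < Real.pi := by
    have := (hG.tendsto t₀).eventually (Metric.ball_mem_nhds (G t₀) Real.pi_pos)
    simpa [Real.dist_eq] using this
  filter_upwards [hnear] with t ht
  rw [abs_lt] at ht
  rw [Complex.log_im, Circle.arg_exp ht.1 ht.2.le]
  ring

/-- The homeomorphism `(x, y) ↦ (b x, y e^{2πi g(x)})` of the two-torus. -/
noncomputable def skewHomeomorph (b : Circle) (g : Circle → ℝ) (hg : Continuous g) :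
    Circle × Circle ≃ₜ Circle × Circle where
  toFun p := (b * p.1, p.2 * Circle.exp (2 * Real.pi * g p.1))
  invFun p := (b⁻¹ * p.1, p.2 * (Circle.exp (2 * Real.pi * g (b⁻¹ * p.1)))⁻¹)
  left_inv p := by simp
  right_inv p := by simp
  continuous_toFun := by fun_prop
  continuous_invFun := by fun_prop

theorem exists_skewHomeomorph_conjugacy {θ : ℝ} {d : ℤ} (hd : d ≠ 0) {f g : Circle → ℝ} {η : ℝ}
    (hgcont : Continuous g)
    (hg : ∀ x : Circle, g x - g (Circle.exp (2 * Real.pi * θ) * x) = f x - η) :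
    ∃ b : Circle, ⇑(skewHomeomorph b g hgcont) ∘ furstenberg θ d f =
      furstenberg θ d 0 ∘ ⇑(skewHomeomorph b g hgcont) := by
  have hb : Circle.exp (2 * Real.pi * η / d) ^ d = Circle.exp (2 * Real.pi * η) := by
    rw [← Circle.exp_intCast_mul, mul_div_cancel₀ _ (Int.cast_ne_zero.2 hd)]
  refine ⟨Circle.exp (2 * Real.pi * η / d), ?_⟩
  funext p
  have hfp : Circle.exp (2 * Real.pi * f p.1)
      * Circle.exp (2 * Real.pi * g (p.1 * Circle.exp (2 * Real.pi * θ)))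
      = Circle.exp (2 * Real.pi * η) * Circle.exp (2 * Real.pi * g p.1) := by
    rw [← Circle.exp_add, ← Circle.exp_add, mul_comm p.1]
    congr 1
    linear_combination (-2 * Real.pi) * hg p.1
  ext1
  · simp [skewHomeomorph, furstenberg, mul_assoc]
  · simp only [skewHomeomorph, furstenberg, Function.comp_apply, Homeomorph.homeomorph_mk_coe,
      Equiv.coe_fn_mk, Pi.zero_apply, mul_zero, Circle.exp_zero, mul_one, mul_zpow, hb]
    rw [mul_assoc, hfp, mul_mul_mul_comm, mul_assoc, mul_mul_mul_comm]
    simp only [mul_comm, mul_left_comm]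

/-- Continuous self-semiconjugacies of the affine Furstenberg transformation. -/
theorem exists_eq_of_comp_furstenberg_zero {θ : ℝ} (hθ : Irrational θ) {d : ℤ} (hd : d ≠ 0)
    {ψ : Circle × Circle → Circle × Circle} (hψ : Continuous ψ)
    (h : ψ ∘ furstenberg θ d 0 = furstenberg θ d 0 ∘ ψ) :
    ∃ (m : ℤ) (c : Circle), ∀ x y, (ψ (x, y)).2 = c * x ^ m * y := by
  have h' : ∀ x y, ψ (x * Circle.exp (2 * Real.pi * θ), x ^ d * y) =
      ((ψ (x, y)).1 * Circle.exp (2 * Real.pi * θ), (ψ (x, y)).1 ^ d * (ψ (x, y)).2) := by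
    intro x y
    simpa [furstenberg] using congrFun h (x, y)
  obtain ⟨k, a, ha⟩ := exists_eq_mul_zpow_of_eigenfunction hθ hd (u := fun p => (ψ p).1)
    (by fun_prop) (Circle.exp (2 * Real.pi * θ)) (fun x y => by simp only [h']; rw [mul_comm])
  have hk : k = 1 := by
    have h1 := ha (1 * Circle.exp (2 * Real.pi * θ)) (1 ^ d * 1)
    rw [h', ha] at h1
    simp only [one_mul, one_zpow, mul_one] at h1
    apply hθ.zpow_circleExp_injective
    simpa using (mul_left_cancel h1).symm
  subst hk
  obtain ⟨m, c, hc⟩ := exists_eq_mul_zpow_of_eigenfunction hθ hd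
    (u := fun p => (ψ p).2 * p.2⁻¹) (by fun_prop) (a ^ d) (fun x y => by
      simp only [h', ha, zpow_one, mul_zpow, mul_inv]
      rw [mul_mul_mul_comm, mul_inv_cancel_right])
  exact ⟨m, c, fun x y => by rw [← hc x y, inv_mul_cancel_right]⟩

theorem contDiff_coe_circle_of_contMDiff {F : ℝ → Circle} (h : ContMDiff 𝓘(ℝ, ℝ) (𝓡 1) 1 F) :
    ContDiff ℝ 1 fun t => (F t : ℂ) := by
  have : Fact (Module.finrank ℝ ℂ = 1 + 1) := ⟨Complex.finrank_real_complex⟩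
  rw [← contMDiff_iff_contDiff]
  exact (contMDiff_coe_sphere (E := ℂ) (n := 1)).comp h

theorem furstenberg_topologically_but_not_C1_conjugate
    (θ : ℝ) (hθ : Irrational θ) (d : ℤ) (hd : d ≠ 0) (f : Circle → ℝ)
    (hf : ContDiff ℝ (⊤ : ℕ∞) fun t : ℝ => f (Circle.exp (2 * Real.pi * t)))
    (g : Circle → ℝ) (hgcont : Continuous g)
    (hg : ∀ x : Circle, g x - g (Circle.exp (2 * Real.pi * θ) * x) = f x - circleMean f)
    (hgnotC1 : ¬ ContDiff ℝ 1 fun t : ℝ => g (Circle.exp (2 * Real.pi * t))) :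
    (∃ Ψ : Circle × Circle ≃ₜ Circle × Circle,
      ⇑Ψ ∘ furstenberg θ d f = furstenberg θ d 0 ∘ ⇑Ψ) ∧
    ∀ ψ : Circle × Circle → Circle × Circle, Continuous ψ →
      ψ ∘ furstenberg θ d f = furstenberg θ d 0 ∘ ψ →
      ¬ ContMDiff ((𝓡 1).prod (𝓡 1)) ((𝓡 1).prod (𝓡 1)) 1 ψ := by
  obtain ⟨b, hΦ⟩ := exists_skewHomeomorph_conjugacy hd hgcont hg
  refine ⟨⟨_, hΦ⟩, fun ψ hψ hcomm hsmooth => hgnotC1 ?_⟩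
  set Φ := skewHomeomorph b g hgcont with hΦdef
  have hcomm' : (ψ ∘ Φ.symm) ∘ furstenberg θ d 0 = furstenberg θ d 0 ∘ (ψ ∘ Φ.symm) := by
    funext p
    have h1 := congrFun hΦ (Φ.symm p)
    have h2 := congrFun hcomm (Φ.symm p)
    simp only [Function.comp_apply, Homeomorph.apply_symm_apply] at h1 h2 ⊢
    rw [← h1, Homeomorph.symm_apply_apply, h2]
  obtain ⟨m, c, hc⟩ := exists_eq_of_comp_furstenberg_zero hθ hd
    (hψ.comp Φ.symm.continuous) hcomm'
  have hψ2 : ∀ x, (ψ (x, 1)).2 = c * (b * x) ^ m * Circle.exp (2 * Real.pi * g x) := by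
    intro x
    have h1 := hc (Φ (x, 1)).1 (Φ (x, 1)).2
    rw [Function.comp_apply, Prod.mk.eta, Homeomorph.symm_apply_apply] at h1
    simpa only [hΦdef, skewHomeomorph, Homeomorph.homeomorph_mk_coe, Equiv.coe_fn_mk, one_mul]
      using h1
  have hexp : ContMDiff 𝓘(ℝ, ℝ) (𝓡 1) 1 fun t : ℝ => Circle.exp (2 * Real.pi * t) :=
    contMDiff_circleExp.comp (contDiff_const.mul contDiff_id).contMDiff
  have hF : ContMDiff 𝓘(ℝ, ℝ) (𝓡 1) 1 fun t : ℝ => (ψ (Circle.exp (2 * Real.pi * t), 1)).2 :=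
    contMDiff_snd.comp (hsmooth.comp (hexp.prodMk contMDiff_const))
  have hFc := contDiff_coe_circle_of_contMDiff hF
  have hlift : ContDiff ℝ 1 fun t : ℝ =>
      m * (2 * Real.pi * t) + 2 * Real.pi * g (Circle.exp (2 * Real.pi * t)) := by
    apply contDiff_of_contDiff_circleExp (by fun_prop)
    have hmul : ContDiff ℝ 1 fun t : ℝ => (((c * b ^ m)⁻¹ : Circle) : ℂ) *
        (ψ (Circle.exp (2 * Real.pi * t), 1)).2 := contDiff_const.mul hFc
    convert hmul using 2 with t
    rw [← Circle.coe_mul, Circle.coe_inj, hψ2, Circle.exp_add, Circle.exp_intCast_mul, mul_zpow]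
    simp only [← mul_assoc]
    simp
  have hlin : ContDiff ℝ 1 fun t : ℝ => (m : ℝ) * (2 * Real.pi * t) := by fun_prop
  have hdiv := (hlift.sub hlin).div_const (2 * Real.pi)
  simpa only [add_sub_cancel_left, mul_div_cancel_left₀ _ Real.two_pi_pos.ne'] using hdiv
end

section
/- Define F : ℝ² → ℝ by F(x, y) = exp(−4/(16x² + y²)) for (x, y) ≠ (0, 0) and F(0, 0) = 0. Let ρ : (0, 1] → ℝ be a C^∞ function such that for every j ≥ 0 there exist constants C_j > 0 and N_j ∈ ℕ with |ρ^{(j)}(r)| ≤ C_j·r^{−N_j} for all r ∈ (0, 1]. Define H on the open unit disk of ℝ² ≅ ℂ by H(0) = 0 and H(z) = F(e^{iρ(|z|)}·z) for 0 < |z| < 1. Then H is C^∞ on the open unit disk, and all partial derivatives of H of every order vanish at the origin. -/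
/-- The function `F(x,y) = exp(−4/(16x² + y²))`, extended by `0` at the origin,
on `ℝ² ≅ ℂ`. -/
noncomputable def ellipticHamiltonian : ℂ → ℝ := fun z =>
  if z = 0 then 0 else Real.exp (-4 / (16 * z.re ^ 2 + z.im ^ 2))

/-- `a z` is bounded on `s` by a polynomial in `‖z‖⁻¹`. -/
def PolyBoundedOn {E : Type*} [NormedAddCommGroup E] (s : Set E) (a : E → ℝ) : Prop :=
  ∃ C : ℝ, 1 ≤ C ∧ ∃ N : ℕ, ∀ z ∈ s, a z ≤ C * (1 + ‖z‖⁻¹) ^ N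

namespace PolyBoundedOn

variable {E : Type*} [NormedAddCommGroup E] {s : Set E} {a b : E → ℝ}

lemma one_le_base (z : E) : 1 ≤ 1 + ‖z‖⁻¹ := by
  have : 0 ≤ ‖z‖⁻¹ := by positivity
  linarith

lemma mono (hb : PolyBoundedOn s b) (h : ∀ z ∈ s, a z ≤ b z) : PolyBoundedOn s a := by
  obtain ⟨C, hC, N, hN⟩ := hb
  exact ⟨C, hC, N, fun z hz => (h z hz).trans (hN z hz)⟩

lemma of_le_const (c : ℝ) (h : ∀ z ∈ s, a z ≤ c) : PolyBoundedOn s a :=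
  ⟨max c 1, le_max_right _ _, 0, fun z hz => by simpa using Or.inl (h z hz)⟩

lemma inv_norm : PolyBoundedOn s fun z => ‖z‖⁻¹ :=
  ⟨1, le_rfl, 1, fun z _ => by simp⟩

lemma add (ha : PolyBoundedOn s a) (hb : PolyBoundedOn s b) :
    PolyBoundedOn s fun z => a z + b z := by
  obtain ⟨C, hC, N, hN⟩ := ha
  obtain ⟨D, hD, M, hM⟩ := hb
  refine ⟨C + D, by linarith, N + M, fun z hz => ?_⟩
  have h1 := one_le_base z
  have hN' : (1 + ‖z‖⁻¹) ^ N ≤ (1 + ‖z‖⁻¹) ^ (N + M) := pow_le_pow_right₀ h1 (by omega)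
  have hM' : (1 + ‖z‖⁻¹) ^ M ≤ (1 + ‖z‖⁻¹) ^ (N + M) := pow_le_pow_right₀ h1 (by omega)
  calc a z + b z ≤ C * (1 + ‖z‖⁻¹) ^ N + D * (1 + ‖z‖⁻¹) ^ M := add_le_add (hN z hz) (hM z hz)
    _ ≤ C * (1 + ‖z‖⁻¹) ^ (N + M) + D * (1 + ‖z‖⁻¹) ^ (N + M) := by gcongr
    _ = _ := by ring

lemma mul (ha : PolyBoundedOn s a) (hb : PolyBoundedOn s b) (hb0 : ∀ z ∈ s, 0 ≤ b z) :
    PolyBoundedOn s fun z => a z * b z := by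
  obtain ⟨C, hC, N, hN⟩ := ha
  obtain ⟨D, hD, M, hM⟩ := hb
  refine ⟨C * D, by nlinarith, N + M, fun z hz => ?_⟩
  calc a z * b z ≤ (C * (1 + ‖z‖⁻¹) ^ N) * (D * (1 + ‖z‖⁻¹) ^ M) :=
        mul_le_mul (hN z hz) (hM z hz) (hb0 z hz) (by positivity)
    _ = _ := by ring

lemma pow (ha : PolyBoundedOn s a) (ha0 : ∀ z ∈ s, 0 ≤ a z) (n : ℕ) :
    PolyBoundedOn s fun z => a z ^ n := by
  induction n with
  | zero => exact of_le_const 1 (by simp)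
  | succ n ih => simpa only [pow_succ] using ih.mul ha ha0

lemma sum {ι : Type*} (t : Finset ι) {f : ι → E → ℝ} (h : ∀ i ∈ t, PolyBoundedOn s (f i)) :
    PolyBoundedOn s fun z => ∑ i ∈ t, f i z := by
  classical
  induction t using Finset.induction_on with
  | empty => exact of_le_const 0 (by simp)
  | insert i t hi ih =>
    simp only [Finset.sum_insert hi]
    exact (h i (by simp)).add (ih fun j hj => h j (by simp [hj]))

end PolyBoundedOn

/-- `f` is smooth on `s` and each of its derivatives is bounded there by a polynomial in
`‖z‖⁻¹`. -/
def HasModerateGrowthOn {E F : Type*} [NormedAddCommGroup E] [NormedSpace ℝ E]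
    [NormedAddCommGroup F] [NormedSpace ℝ F] (s : Set E) (f : E → F) : Prop :=
  ContDiffOn ℝ (⊤ : ℕ∞) f s ∧ ∀ n : ℕ, PolyBoundedOn s fun z => ‖iteratedFDerivWithin ℝ n f s z‖

namespace HasModerateGrowthOn

variable {E F G : Type*} [NormedAddCommGroup E] [NormedSpace ℝ E]
  [NormedAddCommGroup F] [NormedSpace ℝ F] [NormedAddCommGroup G] [NormedSpace ℝ G] {s : Set E}

lemma congr {f g : E → F} (hf : HasModerateGrowthOn s f) (h : Set.EqOn g f s) :
    HasModerateGrowthOn s g :=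
  ⟨hf.1.congr h, fun n => (hf.2 n).mono fun z hz => by rw [iteratedFDerivWithin_congr h hz]⟩

lemma of_contDiff [ProperSpace E] {f : E → F} (hf : ContDiff ℝ (⊤ : ℕ∞) f) (hs : IsOpen s)
    (hb : Bornology.IsBounded s) : HasModerateGrowthOn s f := by
  refine ⟨hf.contDiffOn, fun n => ?_⟩
  have hcont : Continuous (iteratedFDeriv ℝ n f) :=
    hf.continuous_iteratedFDeriv (by exact_mod_cast le_top)
  obtain ⟨C, hC⟩ := hb.isCompact_closure.exists_bound_of_continuousOn hcont.continuousOn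
  refine .of_le_const C fun z hz => ?_
  rw [iteratedFDerivWithin_of_isOpen n hs hz]
  exact hC z (subset_closure hz)

lemma add {f g : E → F} (hs : IsOpen s) (hf : HasModerateGrowthOn s f)
    (hg : HasModerateGrowthOn s g) : HasModerateGrowthOn s fun z => f z + g z := by
  refine ⟨hf.1.add hg.1, fun n => ((hf.2 n).add (hg.2 n)).mono fun z hz => ?_⟩
  have hn : (n : WithTop ℕ∞) ≤ ((⊤ : ℕ∞) : WithTop ℕ∞) := by exact_mod_cast le_top
  rw [fun_iteratedFDerivWithin_add_apply ((hf.1 z hz).of_le hn) ((hg.1 z hz).of_le hn)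
    hs.uniqueDiffOn hz]
  exact norm_add_le _ _

lemma mul {f g : E → ℝ} (hs : IsOpen s) (hf : HasModerateGrowthOn s f)
    (hg : HasModerateGrowthOn s g) : HasModerateGrowthOn s fun z => f z * g z := by
  refine ⟨hf.1.mul hg.1, fun n => PolyBoundedOn.mono
    (.sum (Finset.range (n + 1)) fun i _ => ((PolyBoundedOn.of_le_const (n.choose i : ℝ)
      fun _ _ => le_rfl).mul (hf.2 i) fun _ _ => norm_nonneg _).mul (hg.2 (n - i))
        fun _ _ => norm_nonneg _) fun z hz => ?_⟩
  exact norm_iteratedFDerivWithin_mul_le hf.1 hg.1 hs.uniqueDiffOn hz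
    (by exact_mod_cast le_top)

lemma exists_norm_iteratedFDerivWithin_le_pow {f : E → F} (hf : HasModerateGrowthOn s f) (n : ℕ) :
    ∃ D : E → ℝ, PolyBoundedOn s D ∧ (∀ z, 0 ≤ D z) ∧
      ∀ z ∈ s, ∀ i, 1 ≤ i → i ≤ n → ‖iteratedFDerivWithin ℝ i f s z‖ ≤ D z ^ i := by
  refine ⟨fun z => 1 + ∑ i ∈ Finset.range (n + 1), ‖iteratedFDerivWithin ℝ i f s z‖,
    (PolyBoundedOn.of_le_const 1 fun _ _ => le_rfl).add (.sum _ fun i _ => hf.2 i),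
    fun z => by positivity, fun z hz i hi hin => ?_⟩
  have h0 : 0 ≤ ∑ i ∈ Finset.range (n + 1), ‖iteratedFDerivWithin ℝ i f s z‖ := by positivity
  have h1 : ‖iteratedFDerivWithin ℝ i f s z‖ ≤
      ∑ i ∈ Finset.range (n + 1), ‖iteratedFDerivWithin ℝ i f s z‖ :=
    Finset.single_le_sum (f := fun i => ‖iteratedFDerivWithin ℝ i f s z‖)
      (fun _ _ => norm_nonneg _) (Finset.mem_range.2 (by omega))
  exact (h1.trans (by linarith)).trans (le_self_pow₀ (by linarith) (by omega))

lemma comp {f : E → F} {g : F → G} {t : Set F} (hs : IsOpen s) (ht : UniqueDiffOn ℝ t)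
    (hf : HasModerateGrowthOn s f) (hg : ContDiffOn ℝ (⊤ : ℕ∞) g t) (hst : Set.MapsTo f s t)
    (hgb : ∀ n : ℕ, PolyBoundedOn s fun z => ‖iteratedFDerivWithin ℝ n g t (f z)‖) :
    HasModerateGrowthOn s fun z => g (f z) := by
  refine ⟨hg.comp hf.1 hst, fun n => ?_⟩
  obtain ⟨D, hD, hD0, hDf⟩ := hf.exists_norm_iteratedFDerivWithin_le_pow n
  refine PolyBoundedOn.mono (((PolyBoundedOn.of_le_const (n.factorial : ℝ) fun _ _ => le_rfl).mul
    (.sum (Finset.range (n + 1)) fun i _ => hgb i) fun _ _ => by positivity).mul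
      (hD.pow (fun z _ => hD0 z) n) fun z _ => pow_nonneg (hD0 z) n) fun z hz => ?_
  exact norm_iteratedFDerivWithin_comp_le hg hf.1 (by exact_mod_cast le_top) ht hs.uniqueDiffOn hst
    hz (fun i hi => Finset.single_le_sum (f := fun i => ‖iteratedFDerivWithin ℝ i g t (f z)‖)
      (fun _ _ => norm_nonneg _) (Finset.mem_range.2 (by omega))) (hDf z hz)

lemma comp_of_bounded {f : E → ℝ} {g : ℝ → ℝ} (hs : IsOpen s) (hf : HasModerateGrowthOn s f)
    (hg : ContDiff ℝ (⊤ : ℕ∞) g) (hgb : ∀ n x, |iteratedDeriv n g x| ≤ 1) :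
    HasModerateGrowthOn s fun z => g (f z) := by
  refine hf.comp hs uniqueDiffOn_univ hg.contDiffOn (Set.mapsTo_univ _ _) fun n =>
    .of_le_const 1 fun z _ => ?_
  rw [norm_iteratedFDerivWithin_eq_norm_iteratedDerivWithin, iteratedDerivWithin_univ]
  exact hgb n _

lemma rpow_of_nonpos {f : E → ℝ} (hs : IsOpen s) (hf : HasModerateGrowthOn s f)
    (hpos : ∀ z ∈ s, 0 < f z) (hinv : PolyBoundedOn s fun z => (f z)⁻¹) {p : ℝ} (hp : p ≤ 0) :
    HasModerateGrowthOn s fun z => f z ^ p := by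
  refine hf.comp hs isOpen_Ioi.uniqueDiffOn (t := Set.Ioi 0) (g := fun x => x ^ p)
    (fun x hx => (Real.contDiffAt_rpow_const_of_ne (ne_of_gt hx)).contDiffWithinAt)
    hpos fun n => ?_
  refine PolyBoundedOn.mono ((PolyBoundedOn.of_le_const |(descPochhammer ℝ n).eval p|
    fun _ _ => le_rfl).mul ((PolyBoundedOn.add (.of_le_const 1 fun _ _ => le_rfl) hinv).pow
      (fun z hz => ?_) (n + ⌈-p⌉₊)) fun z hz => ?_) fun z hz => ?_
  · have := inv_pos.2 (hpos z hz)
    positivity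
  · have := inv_pos.2 (hpos z hz)
    positivity
  have hz0 := hpos z hz
  have hinv0 := inv_pos.2 hz0
  rw [norm_iteratedFDerivWithin_eq_norm_iteratedDerivWithin,
    iteratedDerivWithin_of_isOpen_eq_iterate isOpen_Ioi hz0, Real.iter_deriv_rpow_const, norm_mul,
    Real.norm_eq_abs, Real.norm_of_nonneg (Real.rpow_nonneg hz0.le _)]
  gcongr
  calc f z ^ (p - n) = (f z)⁻¹ ^ (n - p) := by
        rw [Real.inv_rpow hz0.le, ← Real.rpow_neg hz0.le, neg_sub]
    _ ≤ (1 + (f z)⁻¹) ^ (n - p) := by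
        have : (0 : ℝ) ≤ n := n.cast_nonneg
        exact Real.rpow_le_rpow hinv0.le (by linarith) (by linarith)
    _ ≤ (1 + (f z)⁻¹) ^ ((n + ⌈-p⌉₊ : ℕ) : ℝ) := by
        refine Real.rpow_le_rpow_of_exponent_le (by linarith) ?_
        have := Nat.le_ceil (-p)
        push_cast
        linarith
    _ = _ := Real.rpow_natCast _ _

end HasModerateGrowthOn

/-- A function with vanishing value at `0`, smooth on a punctured neighbourhood of `0` with all
derivatives `O(‖z‖²)`, is smooth and flat at `0`. -/
lemma contDiffOn_and_iteratedFDeriv_eq_zero_of_flat {E F : Type*} [NormedAddCommGroup E]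
    [NormedSpace ℝ E] [NormedAddCommGroup F] [NormedSpace ℝ F] {s : Set E} (hs : IsOpen s)
    (h0s : (0 : E) ∈ s) {f : E → F} (hf0 : f 0 = 0) (hf : ContDiffOn ℝ (⊤ : ℕ∞) f (s \ {0}))
    (hflat : ∀ n : ℕ, ∃ C : ℝ, ∀ z ∈ s \ {0}, ‖iteratedFDeriv ℝ n f z‖ ≤ C * ‖z‖ ^ 2) :
    ContDiffOn ℝ (⊤ : ℕ∞) f s ∧ ∀ n : ℕ, iteratedFDeriv ℝ n f 0 = 0 := by
  have hderiv (n : ℕ) (hn : iteratedFDeriv ℝ n f 0 = 0) :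
      HasFDerivAt (iteratedFDeriv ℝ n f) (0 : E →L[ℝ] E [×n]→L[ℝ] F) 0 := by
    obtain ⟨C, hC⟩ := hflat n
    refine Asymptotics.IsBigO.hasFDerivAt (n := 2) (.of_bound C ?_) one_lt_two
    filter_upwards [hs.mem_nhds h0s] with z hz
    rcases eq_or_ne z 0 with rfl | hz0
    · simp [hn]
    · simpa using hC z ⟨hz, hz0⟩
  have hzero (n : ℕ) : iteratedFDeriv ℝ n f 0 = 0 := by
    induction n with
    | zero => ext; simp [hf0]
    | succ n ih =>
      rw [iteratedFDeriv_succ_eq_comp_left, Function.comp_apply, (hderiv n ih).fderiv]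
      exact LinearIsometryEquiv.map_zero _
  refine ⟨contDiffOn_of_differentiableOn fun m _ => ?_, hzero⟩
  refine DifferentiableOn.congr (f := iteratedFDeriv ℝ m f) (fun z hz => ?_)
    (iteratedFDerivWithin_of_isOpen m hs)
  rcases eq_or_ne z 0 with rfl | hz0
  · exact (hderiv m (hzero m)).differentiableAt.differentiableWithinAt
  · refine (ContDiffAt.differentiableAt_iteratedFDeriv (n := ((⊤ : ℕ∞) : WithTop ℕ∞)) ?_
      (by exact_mod_cast ENat.natCast_lt_top m)).differentiableWithinAt
    exact hf.contDiffAt ((hs.sdiff isClosed_singleton).mem_nhds ⟨hz, hz0⟩)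

/-- The exponential of a function of moderate growth that tends to `-∞` at least as fast as
`-c / ‖z‖²` has rapidly decreasing derivatives. -/
lemma HasModerateGrowthOn.norm_iteratedFDerivWithin_exp_le {E : Type*} [NormedAddCommGroup E]
    [NormedSpace ℝ E] {s : Set E} (hs : IsOpen s) (hs1 : ∀ z ∈ s, z ≠ 0 ∧ ‖z‖ ≤ 1) {f : E → ℝ}
    (hf : HasModerateGrowthOn s f) {c : ℝ} (hc : 0 < c) (hfc : ∀ z ∈ s, f z ≤ -(c / ‖z‖ ^ 2))
    (n : ℕ) :
    ∃ K : ℝ, ∀ z ∈ s,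
      ‖iteratedFDerivWithin ℝ n (fun z => Real.exp (f z)) s z‖ ≤ K * ‖z‖ ^ 2 := by
  obtain ⟨D, hD, hD0, hDf⟩ := hf.exists_norm_iteratedFDerivWithin_le_pow n
  obtain ⟨C, hC, N, hN⟩ := hD.pow (fun z _ => hD0 z) n
  refine ⟨n.factorial * ((N + 1).factorial / c ^ (N + 1)) * (C * 2 ^ N), fun z hz => ?_⟩
  obtain ⟨hz0, hz1⟩ := hs1 z hz
  have hr : 0 < ‖z‖ := norm_pos_iff.2 hz0
  have hexp : Real.exp (f z) ≤ (N + 1).factorial / c ^ (N + 1) * ‖z‖ ^ (2 * (N + 1)) := by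
    have h1 := Real.pow_div_factorial_le_exp (x := c / ‖z‖ ^ 2) (by positivity) (N + 1)
    have h2 : Real.exp (f z) ≤ (Real.exp (c / ‖z‖ ^ 2))⁻¹ := by
      rw [← Real.exp_neg]
      exact Real.exp_le_exp.2 (hfc z hz)
    refine h2.trans ((inv_anti₀ (by positivity) h1).trans_eq ?_)
    rw [div_pow, ← pow_mul]
    field_simp
  have hbase : C * (1 + ‖z‖⁻¹) ^ N ≤ C * 2 ^ N * ‖z‖⁻¹ ^ N := by
    rw [mul_assoc, ← mul_pow]
    have := (one_le_inv₀ hr).2 hz1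
    gcongr
    linarith
  have hcomp := norm_iteratedFDerivWithin_comp_le (n := n) (N := ((⊤ : ℕ∞) : WithTop ℕ∞))
    (g := Real.exp) (t := Set.univ) (C := Real.exp (f z)) Real.contDiff_exp.contDiffOn hf.1
    (by exact_mod_cast le_top) uniqueDiffOn_univ hs.uniqueDiffOn (Set.mapsTo_univ _ _) hz
    (fun i _ => by
      rw [norm_iteratedFDerivWithin_eq_norm_iteratedDerivWithin, iteratedDerivWithin_univ,
        iteratedDeriv_eq_iterate, Real.iter_deriv_exp, Real.norm_of_nonneg (Real.exp_pos _).le])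
    (hDf z hz)
  calc ‖iteratedFDerivWithin ℝ n (fun z => Real.exp (f z)) s z‖
      ≤ n.factorial * Real.exp (f z) * D z ^ n := hcomp
    _ ≤ n.factorial * ((N + 1).factorial / c ^ (N + 1) * ‖z‖ ^ (2 * (N + 1))) *
          (C * 2 ^ N * ‖z‖⁻¹ ^ N) := by
        have := pow_nonneg (hD0 z) n
        have := (hN z hz).trans hbase
        gcongr
    _ = n.factorial * ((N + 1).factorial / c ^ (N + 1)) * (C * 2 ^ N) * (‖z‖ ^ 2 * ‖z‖ ^ N) := by
        rw [show 2 * (N + 1) = 2 + N + N by ring, pow_add, pow_add, inv_pow]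
        field_simp
        ring
    _ ≤ n.factorial * ((N + 1).factorial / c ^ (N + 1)) * (C * 2 ^ N) * (‖z‖ ^ 2 * 1) := by
        have := pow_le_one₀ (n := N) hr.le hz1
        gcongr
    _ = _ := by ring

theorem twisted_hamiltonian_is_smooth
    (ρ : ℝ → ℝ) (hρ : ContDiffOn ℝ (⊤ : ℕ∞) ρ (Set.Ioc 0 1))
    (hbound : ∀ j : ℕ, ∃ C : ℝ, 0 < C ∧ ∃ N : ℕ, ∀ r ∈ Set.Ioc (0:ℝ) 1,
      |iteratedDerivWithin j ρ (Set.Ioc 0 1) r| ≤ C / r ^ N)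
    (H : ℂ → ℝ)
    (hH0 : H 0 = 0)
    (hH : ∀ z : ℂ, z ≠ 0 → ‖z‖ < 1 →
      H z = ellipticHamiltonian (Complex.exp (Complex.I * (ρ ‖z‖ : ℂ)) * z)) :
    ContDiffOn ℝ (⊤ : ℕ∞) H (Metric.ball 0 1) ∧ ∀ n : ℕ, iteratedFDeriv ℝ n H 0 = 0 := by
  set U : Set ℂ := Metric.ball 0 1 \ {0} with hUdef
  have hU : IsOpen U := Metric.isOpen_ball.sdiff isClosed_singleton
  have hUb : Bornology.IsBounded U := Metric.isBounded_ball.subset Set.sdiff_subset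
  have hU1 (z : ℂ) (hz : z ∈ U) : z ≠ 0 ∧ ‖z‖ < 1 := ⟨hz.2, by simpa using hz.1⟩
  have hre : HasModerateGrowthOn U fun z : ℂ => z.re := .of_contDiff Complex.reCLM.contDiff hU hUb
  have him : HasModerateGrowthOn U fun z : ℂ => z.im := .of_contDiff Complex.imCLM.contDiff hU hUb
  have hconst (c : ℝ) : HasModerateGrowthOn U fun _ : ℂ => c := .of_contDiff contDiff_const hU hUb
  have hsq : HasModerateGrowthOn U fun z : ℂ => ‖z‖ ^ 2 := .of_contDiff (contDiff_norm_sq ℝ) hU hUb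
  have hsqpos (z : ℂ) (hz : z ∈ U) : 0 < ‖z‖ ^ 2 := pow_pos (norm_pos_iff.2 (hU1 z hz).1) 2
  have hsqinv : PolyBoundedOn U fun z : ℂ => (‖z‖ ^ 2)⁻¹ := by
    simpa only [inv_pow] using PolyBoundedOn.inv_norm.pow (fun _ _ => by positivity) 2
  have hnorm : HasModerateGrowthOn U fun z : ℂ => ‖z‖ := by
    refine (hsq.mul hU (hsq.rpow_of_nonpos hU hsqpos hsqinv (p := -(1 / 2))
      (by norm_num))).congr fun z hz => ?_
    have hr : 0 < ‖z‖ := norm_pos_iff.2 (hU1 z hz).1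
    simp only
    rw [Real.rpow_neg (by positivity), ← Real.sqrt_eq_rpow, Real.sqrt_sq hr.le]
    field_simp
  have hmaps : Set.MapsTo (fun z : ℂ => ‖z‖) U (Set.Ioc 0 1) := fun z hz =>
    ⟨norm_pos_iff.2 (hU1 z hz).1, (hU1 z hz).2.le⟩
  have hangle : HasModerateGrowthOn U fun z : ℂ => ρ ‖z‖ := by
    refine hnorm.comp hU (uniqueDiffOn_Ioc 0 1) hρ hmaps fun n => ?_
    obtain ⟨C, hC, N, hN⟩ := hbound n
    refine PolyBoundedOn.mono ((PolyBoundedOn.of_le_const C fun _ _ => le_rfl).mul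
      (PolyBoundedOn.inv_norm.pow (fun _ _ => by positivity) N) fun _ _ => by positivity)
      fun z hz => ?_
    rw [norm_iteratedFDerivWithin_eq_norm_iteratedDerivWithin, inv_pow, ← div_eq_mul_inv]
    exact hN _ (hmaps hz)
  have hcos : HasModerateGrowthOn U fun z : ℂ => Real.cos (ρ ‖z‖) :=
    hangle.comp_of_bounded hU Real.contDiff_cos Real.abs_iteratedDeriv_cos_le_one
  have hsin : HasModerateGrowthOn U fun z : ℂ => Real.sin (ρ ‖z‖) :=
    hangle.comp_of_bounded hU Real.contDiff_sin Real.abs_iteratedDeriv_sin_le_one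
  set w : ℂ → ℂ := fun z => Complex.exp (Complex.I * (ρ ‖z‖ : ℂ)) * z with hw
  have hwexp (z : ℂ) : Complex.exp (Complex.I * (ρ ‖z‖ : ℂ)) =
      ⟨Real.cos (ρ ‖z‖), Real.sin (ρ ‖z‖)⟩ := by
    rw [mul_comm]
    apply Complex.ext <;> simp [Complex.exp_ofReal_mul_I_re, Complex.exp_ofReal_mul_I_im]
  have hwnorm (z : ℂ) : (w z).re ^ 2 + (w z).im ^ 2 = ‖z‖ ^ 2 := by
    have h1 : ‖w z‖ = ‖z‖ := by rw [hw, norm_mul, Complex.norm_exp_I_mul_ofReal, one_mul]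
    rw [← h1, Complex.sq_norm, Complex.normSq_apply]
    ring
  have hwre : HasModerateGrowthOn U fun z => (w z).re := by
    refine ((hcos.mul hU hre).add hU ((hconst (-1)).mul hU (hsin.mul hU him))).congr fun z _ => ?_
    simp only [hw, hwexp, Complex.mul_re]
    ring
  have hwim : HasModerateGrowthOn U fun z => (w z).im := by
    refine ((hcos.mul hU him).add hU (hsin.mul hU hre)).congr fun z _ => ?_
    simp only [hw, hwexp, Complex.mul_im]
  set Q : ℂ → ℝ := fun z => 16 * (w z).re ^ 2 + (w z).im ^ 2 with hQdef
  have hQ : HasModerateGrowthOn U Q := by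
    refine (((hconst 16).mul hU (hwre.mul hU hwre)).add hU (hwim.mul hU hwim)).congr fun z _ => ?_
    simp only [hQdef]
    ring
  have hQge (z : ℂ) : ‖z‖ ^ 2 ≤ Q z := by
    simp only [hQdef]
    linarith [hwnorm z, sq_nonneg (w z).re]
  have hQle (z : ℂ) : Q z ≤ 16 * ‖z‖ ^ 2 := by
    simp only [hQdef]
    linarith [hwnorm z, sq_nonneg (w z).im]
  have hQpos (z : ℂ) (hz : z ∈ U) : 0 < Q z := (hsqpos z hz).trans_le (hQge z)
  have hf : HasModerateGrowthOn U fun z => -4 / Q z := by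
    refine ((hconst (-4)).mul hU (hQ.rpow_of_nonpos hU hQpos (hsqinv.mono fun z hz =>
      inv_anti₀ (hsqpos z hz) (hQge z)) (p := -1) (by norm_num))).congr fun z _ => ?_
    simp only [Real.rpow_neg_one, div_eq_mul_inv]
  have hfle (z : ℂ) (hz : z ∈ U) : -4 / Q z ≤ -((1 / 4) / ‖z‖ ^ 2) := by
    rw [neg_div, neg_le_neg_iff, div_le_div_iff₀ (hsqpos z hz) (hQpos z hz)]
    linarith [hQle z]
  have hHeq : Set.EqOn H (fun z => Real.exp (-4 / Q z)) U := fun z hz => by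
    have hwz : w z ≠ 0 := mul_ne_zero (Complex.exp_ne_zero _) (hU1 z hz).1
    rw [hH z (hU1 z hz).1 (hU1 z hz).2]
    exact if_neg hwz
  refine contDiffOn_and_iteratedFDeriv_eq_zero_of_flat Metric.isOpen_ball (by simp) hH0
    (hf.1.exp.congr hHeq) fun n => ?_
  obtain ⟨K, hK⟩ := hf.norm_iteratedFDerivWithin_exp_le hU
    (fun z hz => ⟨(hU1 z hz).1, (hU1 z hz).2.le⟩) (by norm_num) hfle n
  refine ⟨K, fun z hz => ?_⟩
  rw [← iteratedFDerivWithin_of_isOpen n hU hz, iteratedFDerivWithin_congr hHeq hz]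
  exact hK z hz
end
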